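/- Let (x_t, C_t) be the sequence generated by the NK-means algorithm with step size α satisfying 0 < α < d_min/((1/ρ)N* + λ_M(L)). Then, with c(α) = 2α(d_min − α((1/ρ)N* + λ_M(L))), for every t one has Q^ρ(x_{t+1}) ≤ Q^ρ(x_t) − c(α) ‖x_t − μ_{t+1}‖². In particular, the sequence (Q^ρ(x_t)) is non-increasing. -/

import Mathlib

open scoped BigOperators

noncomputable section

/-! ### Basic (centralized) K-means notions -/

/-- The dataset `D` contains at least `K` distinct points. -/
def HasKDistinct {p : ℕ} (K : ℕ) (D : Multiset (EuclideanSpace ℝ (Fin p))) : Prop :=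
  ∃ S : Finset (EuclideanSpace ℝ (Fin p)), S.card = K ∧ ∀ y ∈ S, y ∈ D

/-- The K-means clustering cost `F(x) = ∑_{y ∈ D} min_k ‖y - x^k‖²`. -/
def kmeansF {p : ℕ} (K : ℕ) (D : Multiset (EuclideanSpace ℝ (Fin p)))
    (x : Fin K → EuclideanSpace ℝ (Fin p)) : ℝ :=
  (D.map fun y => ⨅ k : Fin K, ‖y - x k‖ ^ 2).sum

/-- `P` is a partition of the multiset `D` into `K` (possibly empty) cells. -/
def IsKPartition {p K : ℕ} (D : Multiset (EuclideanSpace ℝ (Fin p)))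
    (P : Fin K → Multiset (EuclideanSpace ℝ (Fin p))) : Prop :=
  ∑ k, P k = D

/-- The distortion cost `H(x, P) = ∑_k ∑_{y ∈ P^k} ‖y - x^k‖²`. -/
def costH {p K : ℕ} (x : Fin K → EuclideanSpace ℝ (Fin p))
    (P : Fin K → Multiset (EuclideanSpace ℝ (Fin p))) : ℝ :=
  ∑ k, ((P k).map fun y => ‖y - x k‖ ^ 2).sum

/-- `(x, P)` is a Lloyd's minimum for the dataset `D`. -/
def IsLloydMin {p K : ℕ} (D : Multiset (EuclideanSpace ℝ (Fin p)))
    (x : Fin K → EuclideanSpace ℝ (Fin p))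
    (P : Fin K → Multiset (EuclideanSpace ℝ (Fin p))) : Prop :=
  IsKPartition D P ∧
    (∀ Q, IsKPartition D Q → costH x P ≤ costH x Q) ∧
    (∀ x', costH x P ≤ costH x' P)

/-- The set `Z` of Lloyd's minima (cluster-center tuples). -/
def LloydZ {p : ℕ} (K : ℕ) (D : Multiset (EuclideanSpace ℝ (Fin p))) :
    Set (Fin K → EuclideanSpace ℝ (Fin p)) :=
  {x | ∃ P, IsLloydMin D x P}

/-- The set `Z̄` of Lloyd's minima whose centers lie in the (closed) convex hull of `D`. -/
def LloydZbar {p : ℕ} (K : ℕ) (D : Multiset (EuclideanSpace ℝ (Fin p))) :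
    Set (Fin K → EuclideanSpace ℝ (Fin p)) :=
  {x ∈ LloydZ K D | ∀ k, x k ∈ convexHull ℝ {y | y ∈ D}}

/-- The set `Z_g` of global minimizers of the K-means cost `F`. -/
def kmeansZg {p : ℕ} (K : ℕ) (D : Multiset (EuclideanSpace ℝ (Fin p))) :
    Set (Fin K → EuclideanSpace ℝ (Fin p)) :=
  {x | ∀ x', kmeansF K D x ≤ kmeansF K D x'}

/-- The global minimum value `F*` of the K-means cost. -/
def Fstar {p : ℕ} (K : ℕ) (D : Multiset (EuclideanSpace ℝ (Fin p))) : ℝ :=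
  sInf (Set.range (kmeansF K D))

/-- `R₀ = max{‖v‖ : v ∈ closed convex hull of D}`. -/
def R0 {p : ℕ} (D : Multiset (EuclideanSpace ℝ (Fin p))) : ℝ :=
  sSup ((fun v => ‖v‖) '' convexHull ℝ {y | y ∈ D})

/-! ### Multi-agent notions -/

section Distributed

variable {p K M : ℕ}

/-- The multi-agent cost `J^ρ(x, C)`; each undirected edge is counted once in the
agreement term. -/
def costJ (ρ : ℝ) (G : SimpleGraph (Fin M)) [DecidableRel G.Adj]
    (x : Fin M → Fin K → EuclideanSpace ℝ (Fin p))
    (C : Fin M → Fin K → Multiset (EuclideanSpace ℝ (Fin p))) : ℝ :=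
  (1 / ρ) * ∑ m, ∑ k, ((C m k).map fun y => ‖y - x m k‖ ^ 2).sum +
    (1 / 2) * ∑ m, ∑ l ∈ G.neighborFinset m, ∑ k, ‖x m k - x l k‖ ^ 2

/-- The multi-agent cost `Q^ρ(x)`. -/
def costQ (ρ : ℝ) (G : SimpleGraph (Fin M)) [DecidableRel G.Adj]
    (Dm : Fin M → Multiset (EuclideanSpace ℝ (Fin p)))
    (x : Fin M → Fin K → EuclideanSpace ℝ (Fin p)) : ℝ :=
  (1 / ρ) * ∑ m, ((Dm m).map fun y => ⨅ k : Fin K, ‖y - x m k‖ ^ 2).sum +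
    (1 / 2) * ∑ m, ∑ l ∈ G.neighborFinset m, ∑ k, ‖x m k - x l k‖ ^ 2

/-- The set of global minimizers `M^ρ_g` of `Q^ρ`. -/
def globQ (ρ : ℝ) (G : SimpleGraph (Fin M)) [DecidableRel G.Adj]
    (Dm : Fin M → Multiset (EuclideanSpace ℝ (Fin p))) (K : ℕ) :
    Set (Fin M → Fin K → EuclideanSpace ℝ (Fin p)) :=
  {x | ∀ x' : Fin M → Fin K → EuclideanSpace ℝ (Fin p), costQ ρ G Dm x ≤ costQ ρ G Dm x'}

/-- `C ∈ U_x` : `C` is an admissible (Voronoi / nearest-center) clustering for `x`. -/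
def InVoronoi (Dm : Fin M → Multiset (EuclideanSpace ℝ (Fin p)))
    (x : Fin M → Fin K → EuclideanSpace ℝ (Fin p))
    (C : Fin M → Fin K → Multiset (EuclideanSpace ℝ (Fin p))) : Prop :=
  (∀ m, IsKPartition (Dm m) (C m)) ∧
    ∀ m k y, y ∈ C m k → ∀ k', ‖y - x m k‖ ≤ ‖y - x m k'‖

/-- The fixed-point (stationarity) equations
`((1/ρ)|C_m^k| + |Ω_m|) x_m^k = (1/ρ) ∑_{y ∈ C_m^k} y + ∑_{l ∈ Ω_m} x_l^k`. -/
def IsFixedCenters (ρ : ℝ) (G : SimpleGraph (Fin M)) [DecidableRel G.Adj]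
    (x : Fin M → Fin K → EuclideanSpace ℝ (Fin p))
    (C : Fin M → Fin K → Multiset (EuclideanSpace ℝ (Fin p))) : Prop :=
  ∀ m k, ((1 / ρ) * ((C m k).card : ℝ) + (G.degree m : ℝ)) • x m k =
      (1 / ρ) • (C m k).sum + ∑ l ∈ G.neighborFinset m, x l k

/-- `(x, C)` is a generalized Lloyd's minimum of `J^ρ`. -/
def IsGenLloydMin (ρ : ℝ) (G : SimpleGraph (Fin M)) [DecidableRel G.Adj]
    (Dm : Fin M → Multiset (EuclideanSpace ℝ (Fin p)))
    (x : Fin M → Fin K → EuclideanSpace ℝ (Fin p))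
    (C : Fin M → Fin K → Multiset (EuclideanSpace ℝ (Fin p))) : Prop :=
  InVoronoi Dm x C ∧ IsFixedCenters ρ G x C

/-- The set `M^ρ` of generalized Lloyd's minima (centers part). -/
def genM (ρ : ℝ) (G : SimpleGraph (Fin M)) [DecidableRel G.Adj]
    (Dm : Fin M → Multiset (EuclideanSpace ℝ (Fin p))) (K : ℕ) :
    Set (Fin M → Fin K → EuclideanSpace ℝ (Fin p)) :=
  {x | ∃ C, IsGenLloydMin ρ G Dm x C}

/-- The set `M̄^ρ` of generalized Lloyd's minima with all centers in the (closed)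
convex hull of the collective dataset `D`. -/
def genMbar (ρ : ℝ) (G : SimpleGraph (Fin M)) [DecidableRel G.Adj]
    (Dm : Fin M → Multiset (EuclideanSpace ℝ (Fin p)))
    (D : Multiset (EuclideanSpace ℝ (Fin p))) (K : ℕ) :
    Set (Fin M → Fin K → EuclideanSpace ℝ (Fin p)) :=
  {x ∈ genM ρ G Dm K | ∀ m k, x m k ∈ convexHull ℝ {y | y ∈ D}}

/-- The update target
`μ_m^k = ((1/ρ) ∑_{y ∈ C_m^k} y + ∑_{l ∈ Ω_m} x_l^k) / ((1/ρ)|C_m^k| + |Ω_m|)`. -/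
def muVec (ρ : ℝ) (G : SimpleGraph (Fin M)) [DecidableRel G.Adj]
    (x : Fin M → Fin K → EuclideanSpace ℝ (Fin p))
    (C : Fin M → Fin K → Multiset (EuclideanSpace ℝ (Fin p)))
    (m : Fin M) (k : Fin K) : EuclideanSpace ℝ (Fin p) :=
  ((1 / ρ) * ((C m k).card : ℝ) + (G.degree m : ℝ))⁻¹ •
    ((1 / ρ) • (C m k).sum + ∑ l ∈ G.neighborFinset m, x l k)

/-- `(x_t, C_t)` is a trajectory of the NK-means algorithm with parameters `ρ, α`. -/
def NKMeansSeq (ρ α : ℝ) (G : SimpleGraph (Fin M)) [DecidableRel G.Adj]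
    (Dm : Fin M → Multiset (EuclideanSpace ℝ (Fin p)))
    (x : ℕ → Fin M → Fin K → EuclideanSpace ℝ (Fin p))
    (C : ℕ → Fin M → Fin K → Multiset (EuclideanSpace ℝ (Fin p))) : Prop :=
  (∀ m, IsKPartition (Dm m) (C 0 m)) ∧
    ∀ t, (∀ m, IsKPartition (Dm m) (C (t + 1) m)) ∧
      (∀ m k y, y ∈ C (t + 1) m k → ∀ k', ‖y - x t m k‖ ≤ ‖y - x t m k'‖) ∧
      ∀ m k, x (t + 1) m k = x t m k - α • (x t m k - muVec ρ G (x t) (C (t + 1)) m k)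

/-- The minimum vertex degree `d_min` of the communication graph. -/
def minDeg (G : SimpleGraph (Fin M)) [DecidableRel G.Adj] : ℕ :=
  sInf (Set.range fun m : Fin M => G.degree m)

/-- The largest eigenvalue `λ_M(L)` of the graph Laplacian. -/
def lapLamMax (G : SimpleGraph (Fin M)) [DecidableRel G.Adj] : ℝ :=
  sSup (spectrum ℝ (G.lapMatrix ℝ))

/-- The second-smallest eigenvalue `λ₂(L)` of the graph Laplacian (for a connected
graph, the smallest nonzero eigenvalue). -/
def lapLam2 (G : SimpleGraph (Fin M)) [DecidableRel G.Adj] : ℝ :=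
  sInf {μ : ℝ | μ ∈ spectrum ℝ (G.lapMatrix ℝ) ∧ μ ≠ 0}

/-- `N* = max_m |D_m|`. -/
def Nstar (Dm : Fin M → Multiset (EuclideanSpace ℝ (Fin p))) : ℕ :=
  Finset.univ.sup fun m => (Dm m).card

/-- The step-size condition `0 < α < d_min / ((1/ρ) N* + λ_M(L))`. -/
def StepOK (ρ α : ℝ) (G : SimpleGraph (Fin M)) [DecidableRel G.Adj]
    (Dm : Fin M → Multiset (EuclideanSpace ℝ (Fin p))) : Prop :=
  0 < α ∧ α * ((1 / ρ) * (Nstar Dm : ℝ) + lapLamMax G) < (minDeg G : ℝ)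

/-- The constant `c(α) = 2α(d_min − α((1/ρ)N* + λ_M(L)))`. -/
def cAlpha (ρ α : ℝ) (G : SimpleGraph (Fin M)) [DecidableRel G.Adj]
    (Dm : Fin M → Multiset (EuclideanSpace ℝ (Fin p))) : ℝ :=
  2 * α * ((minDeg G : ℝ) - α * ((1 / ρ) * (Nstar Dm : ℝ) + lapLamMax G))

end Distributed
open scoped RealInnerProductSpace

theorem Multiset.sum_norm_sub_sub_smul_sq {E : Type*} [NormedAddCommGroup E]
    [InnerProductSpace ℝ E] (S : Multiset E) (a d : E) (α : ℝ) :
    (S.map fun y => ‖y - (a - α • d)‖ ^ 2).sum = (S.map fun y => ‖y - a‖ ^ 2).sum +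
      2 * α * ⟪S.sum - (S.card : ℝ) • a, d⟫ + α ^ 2 * S.card * ‖d‖ ^ 2 := by
  induction S using Multiset.induction_on with
  | empty => simp
  | cons y S ih =>
    have h : ‖y - (a - α • d)‖ ^ 2 = ‖y - a‖ ^ 2 + 2 * α * ⟪y - a, d⟫ + α ^ 2 * ‖d‖ ^ 2 := by
      rw [sub_sub_eq_add_sub, add_sub_right_comm, norm_add_sq_real, inner_smul_right, norm_smul,
        mul_pow, Real.norm_eq_abs, sq_abs]
      ring
    simp only [Multiset.map_cons, Multiset.sum_cons, Multiset.card_cons, Nat.cast_add,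
      Nat.cast_one, ih, h, inner_sub_left, inner_add_left, inner_smul_left, conj_trivial]
    ring

namespace SimpleGraph

variable {V : Type*} [Fintype V] (G : SimpleGraph V) [DecidableRel G.Adj]

theorem sum_sum_neighborFinset_comm {A : Type*} [AddCommMonoid A] (f : V → V → A) :
    ∑ m, ∑ l ∈ G.neighborFinset m, f m l = ∑ m, ∑ l ∈ G.neighborFinset m, f l m :=
  Finset.sum_comm' (by simp [G.adj_comm])

/-- Expansion of the graph Dirichlet energy along the line `α ↦ x - α • d`. -/
theorem sum_norm_sub_sub_smul_sq {E : Type*} [NormedAddCommGroup E] [InnerProductSpace ℝ E]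
    (x d : V → E) (α : ℝ) :
    (1 / 2) * ∑ m, ∑ l ∈ G.neighborFinset m, ‖(x m - α • d m) - (x l - α • d l)‖ ^ 2 =
      (1 / 2) * ∑ m, ∑ l ∈ G.neighborFinset m, ‖x m - x l‖ ^ 2 -
        2 * α * ∑ m, ⟪(G.degree m : ℝ) • x m - ∑ l ∈ G.neighborFinset m, x l, d m⟫ +
        α ^ 2 * ((1 / 2) * ∑ m, ∑ l ∈ G.neighborFinset m, ‖d m - d l‖ ^ 2) := by
  have h (m l : V) : ‖(x m - α • d m) - (x l - α • d l)‖ ^ 2 = ‖x m - x l‖ ^ 2 -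
      2 * α * (⟪x m - x l, d m⟫ + ⟪x l - x m, d l⟫) + α ^ 2 * ‖d m - d l‖ ^ 2 := by
    rw [sub_sub_sub_comm, ← smul_sub, norm_sub_sq_real, inner_smul_right, norm_smul, mul_pow,
      Real.norm_eq_abs, sq_abs, inner_sub_right, ← neg_sub (x m) (x l), inner_neg_left]
    ring
  have hdeg (m : V) : ⟪(G.degree m : ℝ) • x m - ∑ l ∈ G.neighborFinset m, x l, d m⟫ =
      ∑ l ∈ G.neighborFinset m, ⟪x m - x l, d m⟫ := by
    simp [inner_sub_left, inner_smul_left, sum_inner, Finset.sum_sub_distrib]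
  have hsymm := G.sum_sum_neighborFinset_comm fun m l => ⟪x m - x l, d m⟫
  simp only [h, hdeg, Finset.sum_add_distrib, Finset.sum_sub_distrib, ← Finset.mul_sum, ← hsymm]
  ring

variable [DecidableEq V]

theorem half_sum_sq_sub_le (v : V → ℝ) :
    (1 / 2) * ∑ m, ∑ l ∈ G.neighborFinset m, (v m - v l) ^ 2 ≤
      sSup (spectrum ℝ (G.lapMatrix ℝ)) * ∑ m, v m ^ 2 := by
  set r := sSup (spectrum ℝ (G.lapMatrix ℝ)) with hr
  have hpsd : (algebraMap ℝ (Matrix V V ℝ) r - G.lapMatrix ℝ).PosSemidef := by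
    rw [Matrix.posSemidef_iff_isHermitian_and_spectrum_nonneg]
    refine ⟨?_, fun s hs => ?_⟩
    · refine Matrix.IsHermitian.sub ?_ (G.posSemidef_lapMatrix ℝ).1
      rw [Matrix.algebraMap_eq_diagonal]
      exact Matrix.isHermitian_diagonal _
    · rw [← spectrum.singleton_sub_eq] at hs
      obtain ⟨a, rfl, b, hb, rfl⟩ := hs
      exact sub_nonneg.2 (le_csSup (Matrix.finite_real_spectrum).bddAbove hb)
  have h := hpsd.dotProduct_mulVec_nonneg v
  have hL := G.lapMatrix_toLinearMap₂' ℝ v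
  rw [Matrix.toLinearMap₂'_apply'] at hL
  have h1 : (algebraMap ℝ (Matrix V V ℝ) r).mulVec v = r • v := by
    rw [Algebra.algebraMap_eq_smul_one, Matrix.smul_mulVec, Matrix.one_mulVec]
  have h2 : ∑ m, ∑ l, (if G.Adj m l then (v m - v l) ^ 2 else 0) =
      ∑ m, ∑ l ∈ G.neighborFinset m, (v m - v l) ^ 2 := by
    simp [neighborFinset_eq_filter, Finset.sum_filter]
  have h3 : v ⬝ᵥ v = ∑ m, v m ^ 2 := by simp [dotProduct, sq]
  rw [star_trivial, Matrix.sub_mulVec, dotProduct_sub, h1, hL, h2, dotProduct_smul, h3,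
    smul_eq_mul] at h
  linarith

theorem half_sum_norm_sub_sq_le {ι : Type*} [Fintype ι] (d : V → EuclideanSpace ℝ ι) :
    (1 / 2) * ∑ m, ∑ l ∈ G.neighborFinset m, ‖d m - d l‖ ^ 2 ≤
      sSup (spectrum ℝ (G.lapMatrix ℝ)) * ∑ m, ‖d m‖ ^ 2 := by
  have h := Finset.sum_le_sum fun (i : ι) (_ : i ∈ Finset.univ) =>
    G.half_sum_sq_sub_le fun m => d m i
  rw [← Finset.mul_sum, ← Finset.mul_sum, Finset.sum_comm,
    Finset.sum_comm (f := fun i m => d m i ^ 2)] at h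
  simp only [EuclideanSpace.real_norm_sq_eq, PiLp.sub_apply]
  exact (congrArg _ (Finset.sum_congr rfl fun m _ => Finset.sum_comm)).trans_le h

theorem sSup_spectrum_lapMatrix_nonneg : 0 ≤ sSup (spectrum ℝ (G.lapMatrix ℝ)) :=
  Real.sSup_nonneg
    (Matrix.posSemidef_iff_isHermitian_and_spectrum_nonneg.1 (G.posSemidef_lapMatrix ℝ)).2

end SimpleGraph

section Distributed

variable {p K M : ℕ}

theorem sum_map_eq_of_isKPartition {D : Multiset (EuclideanSpace ℝ (Fin p))}
    {P : Fin K → Multiset (EuclideanSpace ℝ (Fin p))} (hP : IsKPartition D P)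
    (f : EuclideanSpace ℝ (Fin p) → ℝ) : (D.map f).sum = ∑ k, ((P k).map f).sum := by
  rw [← hP, ← Multiset.coe_mapAddMonoidHom, map_sum, ← Multiset.coe_sumAddMonoidHom, map_sum]

theorem card_le_Nstar {Dm : Fin M → Multiset (EuclideanSpace ℝ (Fin p))}
    {C : Fin M → Fin K → Multiset (EuclideanSpace ℝ (Fin p))}
    (hC : ∀ m, IsKPartition (Dm m) (C m)) (m : Fin M) (k : Fin K) :
    (C m k).card ≤ Nstar Dm := by
  have h : (C m k).card ≤ (Dm m).card := by
    rw [← hC m]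
    exact Multiset.card_le_card
      (Finset.single_le_sum (f := C m) (fun _ _ => Multiset.zero_le _) (Finset.mem_univ k))
  exact h.trans (Finset.le_sup (f := fun m => (Dm m).card) (Finset.mem_univ m))

variable {ρ : ℝ} {G : SimpleGraph (Fin M)} [DecidableRel G.Adj]
  {Dm : Fin M → Multiset (EuclideanSpace ℝ (Fin p))}
  {x : Fin M → Fin K → EuclideanSpace ℝ (Fin p)}
  {C : Fin M → Fin K → Multiset (EuclideanSpace ℝ (Fin p))}

theorem costQ_le_costJ (hρ : 0 < ρ) (hC : ∀ m, IsKPartition (Dm m) (C m)) :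
    costQ ρ G Dm x ≤ costJ ρ G x C := by
  unfold costQ costJ
  gcongr with m
  rw [sum_map_eq_of_isKPartition (hC m)]
  gcongr with k
  exact Multiset.sum_map_le_sum_map _ _ fun y _ => ciInf_le (Set.finite_range _).bddBelow k

theorem costQ_eq_costJ (hC : InVoronoi Dm x C) : costQ ρ G Dm x = costJ ρ G x C := by
  unfold costQ costJ
  congr 2
  refine Finset.sum_congr rfl fun m _ => ?_
  rw [sum_map_eq_of_isKPartition (hC.1 m)]
  refine Finset.sum_congr rfl fun k _ => ?_
  refine congrArg _ (Multiset.map_congr rfl fun y hy => le_antisymm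
    (ciInf_le (Set.finite_range _).bddBelow k) ?_)
  have : Nonempty (Fin K) := ⟨k⟩
  exact le_ciInf fun k' => by gcongr; exact hC.2 m k y hy k'

theorem weight_smul_sub_muVec {m : Fin M} {k : Fin K}
    (hw : (1 / ρ) * ((C m k).card : ℝ) + (G.degree m : ℝ) ≠ 0) :
    ((1 / ρ) * ((C m k).card : ℝ) + (G.degree m : ℝ)) • (x m k - muVec ρ G x C m k) =
      (G.degree m : ℝ) • x m k - ∑ l ∈ G.neighborFinset m, x l k -
        (1 / ρ) • ((C m k).sum - ((C m k).card : ℝ) • x m k) := by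
  rw [smul_sub, muVec, smul_inv_smul₀ hw]
  module

/-- Expansion of `J^ρ(·, C)` along the line `α ↦ x - α • d`. -/
theorem costJ_sub_smul (d : Fin M → Fin K → EuclideanSpace ℝ (Fin p)) (α : ℝ) :
    costJ ρ G (fun m k => x m k - α • d m k) C = costJ ρ G x C -
      2 * α * ∑ m, ∑ k, ⟪(G.degree m : ℝ) • x m k - ∑ l ∈ G.neighborFinset m, x l k -
        (1 / ρ) • ((C m k).sum - ((C m k).card : ℝ) • x m k), d m k⟫ +
      α ^ 2 * (∑ m, ∑ k, (1 / ρ) * (C m k).card * ‖d m k‖ ^ 2 +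
        ∑ k, (1 / 2) * ∑ m, ∑ l ∈ G.neighborFinset m, ‖d m k - d l k‖ ^ 2) := by
  have hedge (z : Fin M → Fin K → EuclideanSpace ℝ (Fin p)) :
      (1 / 2) * ∑ m, ∑ l ∈ G.neighborFinset m, ∑ k, ‖z m k - z l k‖ ^ 2 =
        ∑ k, (1 / 2) * ∑ m, ∑ l ∈ G.neighborFinset m, ‖z m k - z l k‖ ^ 2 := by
    rw [← Finset.mul_sum, Finset.sum_comm]
    exact congrArg _ (Finset.sum_congr rfl fun m _ => Finset.sum_comm)
  have hsum : ∑ m, ∑ k, ⟪(G.degree m : ℝ) • x m k - ∑ l ∈ G.neighborFinset m, x l k, d m k⟫ =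
      ∑ k, ∑ m, ⟪(G.degree m : ℝ) • x m k - ∑ l ∈ G.neighborFinset m, x l k, d m k⟫ :=
    Finset.sum_comm
  simp only [costJ, hedge, Multiset.sum_norm_sub_sub_smul_sq,
    fun k => G.sum_norm_sub_sub_smul_sq (x · k) (d · k) α]
  simp only [inner_sub_left _ ((1 / ρ) • _), inner_smul_left ((C _ _).sum - _), conj_trivial,
    Finset.sum_add_distrib, Finset.sum_sub_distrib, ← Finset.mul_sum, mul_assoc, hsum]
  ring

theorem costJ_sub_smul_muVec_le {α : ℝ} (hρ : 0 < ρ) (hα : StepOK ρ α G Dm)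
    (hC : ∀ m, IsKPartition (Dm m) (C m)) :
    costJ ρ G (fun m k => x m k - α • (x m k - muVec ρ G x C m k)) C ≤ costJ ρ G x C -
      cAlpha ρ α G Dm * ∑ m, ∑ k, ‖x m k - muVec ρ G x C m k‖ ^ 2 := by
  obtain ⟨hα0, hα1⟩ := hα
  have hlam : 0 ≤ lapLamMax G := G.sSup_spectrum_lapMatrix_nonneg
  have hstep : 0 ≤ (1 / ρ) * (Nstar Dm : ℝ) + lapLamMax G := by positivity
  have hmin : 0 < (minDeg G : ℝ) := (mul_nonneg hα0.le hstep).trans_lt hα1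
  have hdeg (m : Fin M) : (minDeg G : ℝ) ≤ G.degree m :=
    Nat.cast_le.2 (Nat.sInf_le ⟨m, rfl⟩)
  have hw (m : Fin M) (k : Fin K) :
      (minDeg G : ℝ) ≤ (1 / ρ) * ((C m k).card : ℝ) + (G.degree m : ℝ) :=
    (hdeg m).trans (le_add_of_nonneg_left (by positivity))
  rw [costJ_sub_smul]
  set d := fun m k => x m k - muVec ρ G x C m k with hd
  have hlin : (minDeg G : ℝ) * ∑ m, ∑ k, ‖d m k‖ ^ 2 ≤
      ∑ m, ∑ k, ⟪(G.degree m : ℝ) • x m k - ∑ l ∈ G.neighborFinset m, x l k -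
        (1 / ρ) • ((C m k).sum - ((C m k).card : ℝ) • x m k), d m k⟫ := by
    simp only [Finset.mul_sum]
    gcongr with m _ k
    rw [← weight_smul_sub_muVec (hmin.trans_le (hw m k)).ne', inner_smul_left, conj_trivial,
      real_inner_self_eq_norm_sq]
    exact mul_le_mul_of_nonneg_right (hw m k) (sq_nonneg _)
  have hdata : ∑ m, ∑ k, (1 / ρ) * (C m k).card * ‖d m k‖ ^ 2 ≤
      (1 / ρ) * Nstar Dm * ∑ m, ∑ k, ‖d m k‖ ^ 2 := by
    simp only [Finset.mul_sum]
    gcongr with m _ k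
    exact card_le_Nstar hC m k
  have hgraph : ∑ k, (1 / 2) * ∑ m, ∑ l ∈ G.neighborFinset m, ‖d m k - d l k‖ ^ 2 ≤
      lapLamMax G * ∑ m, ∑ k, ‖d m k‖ ^ 2 := by
    rw [Finset.sum_comm, Finset.mul_sum]
    exact Finset.sum_le_sum fun k _ => G.half_sum_norm_sub_sq_le (d · k)
  have hS : 0 ≤ ∑ m, ∑ k, ‖d m k‖ ^ 2 := by positivity
  have h1 := mul_le_mul_of_nonneg_left hlin (by positivity : 0 ≤ 2 * α)
  have h2 := mul_le_mul_of_nonneg_left (add_le_add hdata hgraph) (sq_nonneg α)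
  have h3 := mul_nonneg (sq_nonneg α) (mul_nonneg hstep hS)
  rw [cAlpha]
  change _ ≤ _ - _ * ∑ m, ∑ k, ‖d m k‖ ^ 2
  linarith

end Distributed

/-- Corollary 3, monotone cost improvement for `Q^ρ`: along any
NK-means trajectory, `Q^ρ(x_{t+1}) ≤ Q^ρ(x_t) − c(α) ‖x_t − μ_{t+1}‖²`; in particular
`t ↦ Q^ρ(x_t)` is non-increasing. -/
theorem stmt9 {p K M : ℕ}
    (Dm : Fin M → Multiset (EuclideanSpace ℝ (Fin p)))
    (G : SimpleGraph (Fin M)) [DecidableRel G.Adj] (hconn : G.Connected)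
    (ρ α : ℝ) (hρ : 0 < ρ) (hα : StepOK ρ α G Dm)
    (x : ℕ → Fin M → Fin K → EuclideanSpace ℝ (Fin p))
    (C : ℕ → Fin M → Fin K → Multiset (EuclideanSpace ℝ (Fin p)))
    (hseq : NKMeansSeq ρ α G Dm x C) :
    (∀ t, costQ ρ G Dm (x (t + 1)) ≤ costQ ρ G Dm (x t) -
        cAlpha ρ α G Dm * ∑ m, ∑ k, ‖x t m k - muVec ρ G (x t) (C (t + 1)) m k‖ ^ 2) ∧
      Antitone fun t => costQ ρ G Dm (x t) := by
  have hstep (t : ℕ) : costQ ρ G Dm (x (t + 1)) ≤ costQ ρ G Dm (x t) -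
      cAlpha ρ α G Dm * ∑ m, ∑ k, ‖x t m k - muVec ρ G (x t) (C (t + 1)) m k‖ ^ 2 := by
    obtain ⟨hpart, hnear, hupd⟩ := hseq.2 t
    rw [costQ_eq_costJ ⟨hpart, hnear⟩, funext fun m => funext (hupd m)]
    exact (costQ_le_costJ hρ hpart).trans (costJ_sub_smul_muVec_le hρ hα hpart)
  refine ⟨hstep, antitone_nat_of_succ_le fun t => (hstep t).trans (sub_le_self _ ?_)⟩
  have hc : 0 ≤ cAlpha ρ α G Dm :=
    mul_nonneg (mul_nonneg zero_le_two hα.1.le) (sub_nonneg.2 hα.2.le)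
  positivity
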